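/- arXiv:2109.13369 — 2 statements merged into one kernel-verified Lean document; each statement's English description precedes it below -/
import Mathlib

section
/- Let d ≥ 1, let f : ℝ^d → ℂ be integrable, let (x₀, ξ₀) ∈ ℝ^d × (ℝ^d ∖ {0}), and let Q be a real symmetric positive-definite d×d matrix with associated quadratic form q(z) := Σ_{j,k} Q_{jk} z_j z_k extended ℂ-bilinearly to ℂ^d. Then the following are equivalent: (a) there exist an open neighborhood 𝒵 of x₀ − iξ₀ in ℂ^d and constants ε > 0, C > 0 with |∫_{ℝ^d} e^{−(μ/2)(z−x)²} f(x) dx| ≤ C e^{(μ/2)((Im z)² − ε)} for all z ∈ 𝒵, μ ≥ 1; (b) there exist an open neighborhood 𝒩 of x₀ − iQ⁻¹ξ₀ in ℂ^d and constants ε > 0, C > 0 with |∫_{ℝ^d} e^{−(μ/2) q(z−x)} f(x) dx| ≤ C e^{(μ/2)(q(Im z) − ε)} for all z ∈ 𝒩, μ ≥ 1. -/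
open MeasureTheory

/-- The ℂ-bilinear extension of the quadratic form `⟨Qz,z⟩` of a real `d × d`
matrix `Q` to `ℂ^d`. -/
noncomputable def quadFormC {d : ℕ} (Q : Matrix (Fin d) (Fin d) ℝ) (z : Fin d → ℂ) : ℂ :=
  ∑ j, ∑ k, (Q j k : ℂ) * z j * z k

/-- The real quadratic form `⟨Qv,v⟩` of a real `d × d` matrix `Q`. -/
noncomputable def quadFormR {d : ℕ} (Q : Matrix (Fin d) (Fin d) ℝ) (v : Fin d → ℝ) : ℝ :=
  ∑ j, ∑ k, Q j k * v j * v k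


open Matrix Filter Topology

/-- The (real variable) Gaussian wave packet kernel attached to `Q`. -/
noncomputable def wpKer {d : ℕ} (Q : Matrix (Fin d) (Fin d) ℝ) (μ : ℝ) (s ξ : Fin d → ℝ) : ℂ :=
  Complex.exp (((-(μ / 2) * (s ⬝ᵥ Q *ᵥ s) : ℝ) : ℂ) + ((μ * (s ⬝ᵥ ξ) : ℝ) : ℂ) * Complex.I)

/-- The wave packet transform. -/
noncomputable def wpT {d : ℕ} (Q : Matrix (Fin d) (Fin d) ℝ) (f : (Fin d → ℝ) → ℂ) (μ : ℝ)
    (x ξ : Fin d → ℝ) : ℂ := ∫ y, wpKer Q μ (x - y) ξ * f y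

/-- Exponential smallness near a point of phase space. -/
def wpSmall {d : ℕ} (Q : Matrix (Fin d) (Fin d) ℝ) (f : (Fin d → ℝ) → ℂ)
    (x₀ ξ₀ : Fin d → ℝ) : Prop :=
  ∃ ε > (0 : ℝ), ∃ C > (0 : ℝ), ∀ᶠ p : (Fin d → ℝ) × (Fin d → ℝ) in 𝓝 (x₀, ξ₀),
    ∀ μ : ℝ, 1 ≤ μ → ‖wpT Q f μ p.1 p.2‖ ≤ C * Real.exp (-(ε * μ))

/-- Normalizing constant. -/
noncomputable def wpC (d : ℕ) (μ : ℝ) : ℝ := (Real.pi / (μ / 2)) ^ ((d : ℝ) / 2)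

lemma wpC_pos (d : ℕ) {μ : ℝ} (hμ : 0 < μ) : 0 < wpC d μ := by
  unfold wpC; have := Real.pi_pos; positivity

lemma wpC_mul (d : ℕ) {μ κ : ℝ} (hμ : 0 < μ) (hκ : 0 < κ) :
    wpC d (κ * μ) = (κ⁻¹) ^ ((d : ℝ) / 2) * wpC d μ := by
  unfold wpC
  have := Real.pi_pos
  rw [← Real.mul_rpow (by positivity) (by positivity)]
  congr 1
  field_simp

lemma wp_gauss {d : ℕ} {μ : ℝ} (hμ : 0 < μ) (c : Fin d → ℂ) :
    ∫ v : Fin d → ℝ, Complex.exp (((-(μ / 2) * (v ⬝ᵥ v) : ℝ) : ℂ) + ∑ i, c i * v i)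
      = (wpC d μ : ℂ) * Complex.exp ((∑ i, c i ^ 2) / (2 * μ)) := by
  have hb : 0 < (((μ / 2 : ℝ)) : ℂ).re := by simpa using hμ
  have h := GaussianFourier.integral_cexp_neg_mul_sum_add hb c
  have e1 : (4 * ((μ / 2 : ℝ) : ℂ)) = 2 * μ := by push_cast; ring
  have e2 : ((Real.pi : ℂ) / ((μ / 2 : ℝ) : ℂ)) ^ ((Fintype.card (Fin d) : ℂ) / 2)
      = (wpC d μ : ℂ) := by
    unfold wpC
    rw [Complex.ofReal_cpow (by have := Real.pi_pos; positivity)]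
    push_cast
    simp
  rw [e1, e2] at h
  rw [← h]
  congr 1
  ext v
  congr 2
  simp only [dotProduct]
  push_cast
  congr 1
  simp [pow_two]

lemma wp_gauss_integrable (d : ℕ) {μ : ℝ} (hμ : 0 < μ) :
    Integrable (fun v : Fin d → ℝ => Real.exp (-(μ / 2) * (v ⬝ᵥ v))) := by
  have hb : 0 < (((μ / 2 : ℝ)) : ℂ).re := by simpa using hμ
  have h := (GaussianFourier.integrable_cexp_neg_mul_sum_add (ι := Fin d) hb 0).norm
  refine h.congr (Eventually.of_forall fun v => ?_)
  have : (-((μ / 2 : ℝ) : ℂ) * ∑ i, (v i : ℂ) ^ 2 + ∑ i, (0 : Fin d → ℂ) i * v i)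
     = ((-(μ / 2) * (v ⬝ᵥ v) : ℝ) : ℂ) := by
    simp [dotProduct, pow_two]
  simp only [this, Complex.norm_exp, Complex.ofReal_re]

lemma wp_gauss_real (d : ℕ) {μ : ℝ} (hμ : 0 < μ) :
    ∫ v : Fin d → ℝ, Real.exp (-(μ / 2) * (v ⬝ᵥ v)) = wpC d μ := by
  have h := wp_gauss (d := d) hμ 0
  simp only [Pi.zero_apply, zero_mul, Finset.sum_const_zero, add_zero, ne_eq, OfNat.ofNat_ne_zero,
    not_false_eq_true, zero_pow, zero_div, Complex.exp_zero, mul_one, ← Complex.ofReal_exp] at h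
  rw [integral_complex_ofReal] at h
  exact_mod_cast h

lemma wpKer_norm_le {d : ℕ} {Q : Matrix (Fin d) (Fin d) ℝ} (hQ : ∀ s, 0 ≤ s ⬝ᵥ Q *ᵥ s)
    {μ : ℝ} (hμ : 0 < μ) (s ξ : Fin d → ℝ) : ‖wpKer Q μ s ξ‖ ≤ 1 := by
  unfold wpKer
  rw [Complex.norm_exp]
  simp only [Complex.add_re, Complex.ofReal_re, Complex.mul_re, Complex.I_re, Complex.I_im,
    Complex.ofReal_im, mul_zero, mul_one, sub_zero, add_zero, Real.exp_le_one_iff]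
  have := hQ s
  nlinarith [mul_nonneg hμ.le this]

lemma wpKer_continuous {d : ℕ} (Q : Matrix (Fin d) (Fin d) ℝ) (μ : ℝ) :
    Continuous fun p : (Fin d → ℝ) × (Fin d → ℝ) => wpKer Q μ p.1 p.2 := by
  unfold wpKer
  simp only [dotProduct, mulVec]
  fun_prop

lemma wpT_norm_le {d : ℕ} {Q : Matrix (Fin d) (Fin d) ℝ} (hQ : ∀ s, 0 ≤ s ⬝ᵥ Q *ᵥ s)
    {f : (Fin d → ℝ) → ℂ} (hf : Integrable f)
    {μ : ℝ} (hμ : 0 < μ) (x ξ : Fin d → ℝ) : ‖wpT Q f μ x ξ‖ ≤ ∫ y, ‖f y‖ := by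
  unfold wpT
  refine norm_integral_le_of_norm_le hf.norm (Eventually.of_forall fun y => ?_)
  rw [norm_mul]
  exact mul_le_of_le_one_left (norm_nonneg _) (wpKer_norm_le hQ hμ _ _)

/-- The superposition step. -/
lemma wp_step {d : ℕ} {A A' K J : Matrix (Fin d) (Fin d) ℝ} (hA : ∀ s, 0 ≤ s ⬝ᵥ A *ᵥ s)
    {f : (Fin d → ℝ) → ℂ} (hf : Integrable f) (x₀ ξ₀ : Fin d → ℝ) {κ : ℝ} (hκ : 0 < κ)
    (W : ℝ → (Fin d → ℝ) → (Fin d → ℝ) → ℂ) (hWc : ∀ μ ξ, Continuous (W μ ξ))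
    (hWb : ∀ μ, 0 < μ → ∀ ξ v, ‖W μ ξ v‖ ≤ Real.exp (-(μ * κ) * (v ⬝ᵥ v)))
    (hid : ∀ μ, 0 < μ → ∀ s ξ, (wpC d μ : ℂ) * wpKer A' μ s ξ
      = ∫ v, W μ ξ v * wpKer A μ (s + K *ᵥ v) (ξ + J *ᵥ v))
    (h : wpSmall A f x₀ ξ₀) : wpSmall A' f x₀ ξ₀ := by
  obtain ⟨ε, hε, C, hC, hev⟩ := h
  set C0 := ∫ y, ‖f y‖ with hC0
  have hC0n : 0 ≤ C0 := integral_nonneg fun _ => norm_nonneg _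
  have hcont : Continuous fun q : ((Fin d → ℝ) × (Fin d → ℝ)) × (Fin d → ℝ) =>
      (q.1.1 + K *ᵥ q.2, q.1.2 + J *ᵥ q.2) := by
    exact ((continuous_fst.comp continuous_fst).add
        (continuous_const.matrix_mulVec continuous_snd)).prodMk
      ((continuous_snd.comp continuous_fst).add (continuous_const.matrix_mulVec continuous_snd))
  have hev2 : ∀ᶠ q : ((Fin d → ℝ) × (Fin d → ℝ)) × (Fin d → ℝ) in 𝓝 ((x₀, ξ₀), 0),
      ∀ μ : ℝ, 1 ≤ μ → ‖wpT A f μ (q.1.1 + K *ᵥ q.2) (q.1.2 + J *ᵥ q.2)‖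
        ≤ C * Real.exp (-(ε * μ)) := by
    have ht := hcont.tendsto ((x₀, ξ₀), 0)
    simp only [mulVec_zero, add_zero] at ht
    exact ht.eventually hev
  rw [nhds_prod_eq, eventually_prod_iff] at hev2
  obtain ⟨pa, hpa, pb, hpb, hpp⟩ := hev2
  obtain ⟨ρ, hρ, hball⟩ := Metric.eventually_nhds_iff_ball.1 hpb
  have hsmall : ∀ v : Fin d → ℝ, v ⬝ᵥ v < ρ ^ 2 → pb v := by
    intro v hv
    apply hball
    rw [mem_ball_zero_iff, pi_norm_lt_iff hρ]
    intro i
    rw [Real.norm_eq_abs]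
    apply abs_lt_of_sq_lt_sq _ hρ.le
    refine lt_of_le_of_lt ?_ hv
    rw [pow_two]
    exact Finset.single_le_sum (f := fun i => v i * v i) (fun i _ => mul_self_nonneg _)
      (Finset.mem_univ i)
  set ε' := min ε (κ / 2 * ρ ^ 2) with hε'
  have hε'0 : 0 < ε' := lt_min hε (by positivity)
  refine ⟨ε', hε'0, (κ⁻¹) ^ ((d : ℝ) / 2) * (C + C0), by positivity, ?_⟩
  filter_upwards [hpa] with p hp μ hμ
  have hμ0 : 0 < μ := by linarith
  have hWb' := hWb μ hμ0 p.2
  have hgi : Integrable (fun v : Fin d → ℝ => Real.exp (-((2 * κ * μ) / 2) * (v ⬝ᵥ v))) :=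
    wp_gauss_integrable d (by positivity)
  -- Fubini
  have hprod : Integrable (Function.uncurry fun (v y : Fin d → ℝ) =>
      W μ p.2 v * wpKer A μ (p.1 - y + K *ᵥ v) (p.2 + J *ᵥ v) * f y)
      ((volume : Measure (Fin d → ℝ)).prod volume) := by
    refine (hgi.mul_prod hf.norm).mono ?_ ?_
    · refine AEStronglyMeasurable.mul ?_ hf.aestronglyMeasurable.comp_snd
      apply Continuous.aestronglyMeasurable
      refine ((hWc μ p.2).comp continuous_fst).mul ?_
      refine (wpKer_continuous A μ).comp
        (f := fun q : (Fin d → ℝ) × (Fin d → ℝ) => (p.1 - q.2 + K *ᵥ q.1, p.2 + J *ᵥ q.1)) ?_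
      exact ((continuous_const.sub continuous_snd).add
          (continuous_const.matrix_mulVec continuous_fst)).prodMk
        (continuous_const.add (continuous_const.matrix_mulVec continuous_fst))
    · refine Eventually.of_forall fun q => ?_
      simp only [Function.uncurry, norm_mul, Real.norm_eq_abs, Real.abs_exp, abs_norm]
      have h1 := hWb' q.1
      have h2 := wpKer_norm_le hA hμ0 (p.1 - q.2 + K *ᵥ q.1) (p.2 + J *ᵥ q.1)
      have h3 : -((2 * κ * μ) / 2) = -(μ * κ) := by ring
      rw [h3]
      refine mul_le_mul_of_nonneg_right ?_ (norm_nonneg _)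
      calc _ ≤ Real.exp (-(μ * κ) * (q.1 ⬝ᵥ q.1)) * 1 :=
            mul_le_mul h1 h2 (norm_nonneg _) (Real.exp_pos _).le
        _ = _ := mul_one _
  have hrep : (wpC d μ : ℂ) * wpT A' f μ p.1 p.2
      = ∫ v, W μ p.2 v * wpT A f μ (p.1 + K *ᵥ v) (p.2 + J *ᵥ v) := by
    have e1 : ∀ v, W μ p.2 v * wpT A f μ (p.1 + K *ᵥ v) (p.2 + J *ᵥ v)
        = ∫ y, W μ p.2 v * wpKer A μ (p.1 - y + K *ᵥ v) (p.2 + J *ᵥ v) * f y := by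
      intro v
      unfold wpT
      rw [← integral_const_mul]
      congr 1
      ext y
      rw [← mul_assoc, add_sub_right_comm]
    simp_rw [e1]
    rw [integral_integral_swap hprod]
    unfold wpT
    rw [← integral_const_mul]
    congr 1
    ext y
    rw [← mul_assoc, hid μ hμ0, integral_mul_const]
  have hbd : ∀ v, ‖W μ p.2 v * wpT A f μ (p.1 + K *ᵥ v) (p.2 + J *ᵥ v)‖
      ≤ (C + C0) * Real.exp (-(ε' * μ)) * Real.exp (-((κ * μ) / 2) * (v ⬝ᵥ v)) := by
    intro v
    have hvv : 0 ≤ v ⬝ᵥ v := Finset.sum_nonneg fun i _ => mul_self_nonneg _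
    have hw := hWb' v
    rw [norm_mul]
    by_cases hv : v ⬝ᵥ v < ρ ^ 2
    · have hT := hpp hp (hsmall v hv) μ hμ
      simp only at hT
      have : ‖W μ p.2 v‖ ≤ Real.exp (-((κ * μ) / 2) * (v ⬝ᵥ v)) := by
        refine hw.trans (Real.exp_le_exp.2 ?_)
        have : 0 ≤ (κ * μ) * (v ⬝ᵥ v) := by positivity
        nlinarith
      have h2 : C * Real.exp (-(ε * μ)) ≤ (C + C0) * Real.exp (-(ε' * μ)) := by
        refine mul_le_mul (by linarith) (Real.exp_le_exp.2 ?_) (Real.exp_pos _).le (by positivity)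
        have : ε' ≤ ε := min_le_left _ _
        nlinarith
      rw [mul_comm]
      exact mul_le_mul (hT.trans h2) this (norm_nonneg _) (by positivity)
    · push Not at hv
      have hT := wpT_norm_le hA hf hμ0 (p.1 + K *ᵥ v) (p.2 + J *ᵥ v)
      have h2 : ‖W μ p.2 v‖ ≤ Real.exp (-(ε' * μ)) * Real.exp (-((κ * μ) / 2) * (v ⬝ᵥ v)) := by
        rw [← Real.exp_add]
        refine hw.trans (Real.exp_le_exp.2 ?_)
        have h3 : ε' ≤ κ / 2 * ρ ^ 2 := min_le_right _ _
        have h4 : κ / 2 * ρ ^ 2 ≤ κ / 2 * (v ⬝ᵥ v) := by gcongr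
        have h5 : ε' * μ ≤ κ / 2 * (v ⬝ᵥ v) * μ := by gcongr; exact h3.trans h4
        linarith
      calc _ ≤ (Real.exp (-(ε' * μ)) * Real.exp (-((κ * μ) / 2) * (v ⬝ᵥ v))) * (C + C0) := by
            refine mul_le_mul h2 ?_ (norm_nonneg _) (by positivity)
            linarith
        _ = _ := by ring
  have hfin : ‖(wpC d μ : ℂ) * wpT A' f μ p.1 p.2‖
      ≤ (C + C0) * Real.exp (-(ε' * μ)) * wpC d (κ * μ) := by
    rw [hrep, ← wp_gauss_real d (μ := κ * μ) (by positivity), ← integral_const_mul]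
    refine norm_integral_le_of_norm_le ?_ (Eventually.of_forall hbd)
    exact (wp_gauss_integrable d (by positivity)).const_mul _
  have hc := wpC_pos d hμ0
  rw [wpC_mul d hμ0 hκ, norm_mul, Complex.norm_real, Real.norm_eq_abs, abs_of_pos hc] at hfin
  refine le_of_mul_le_mul_left ?_ hc
  linarith

lemma wp_factor {d : ℕ} {Q : Matrix (Fin d) (Fin d) ℝ} (hQ : Q.PosDef) :
    ∃ L : Matrix (Fin d) (Fin d) ℝ, IsUnit L ∧ Q = Lᵀ * L := by
  open scoped MatrixOrder Matrix.Norms.L2Operator in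
  obtain ⟨L, hL, h⟩ := CStarAlgebra.isStrictlyPositive_iff_eq_star_mul_self.1
    (Matrix.isStrictlyPositive_iff_posDef.2 hQ)
  exact ⟨L, hL, by rw [h, star_eq_conjTranspose, conjTranspose_eq_transpose_of_trivial]⟩

lemma wp_dot_factor {d : ℕ} (L : Matrix (Fin d) (Fin d) ℝ) (s : Fin d → ℝ) :
    s ⬝ᵥ (Lᵀ * L) *ᵥ s = (L *ᵥ s) ⬝ᵥ (L *ᵥ s) := by
  rw [← mulVec_mulVec, dotProduct_mulVec, vecMul_transpose]

lemma wp_dot_self_nonneg {d : ℕ} (v : Fin d → ℝ) : 0 ≤ v ⬝ᵥ v :=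
  Finset.sum_nonneg fun i _ => mul_self_nonneg _

/-- Cauchy-Schwarz. -/
lemma wp_cs {d : ℕ} (v w : Fin d → ℝ) : (v ⬝ᵥ w) ^ 2 ≤ (v ⬝ᵥ v) * (w ⬝ᵥ w) := by
  have := Finset.sum_mul_sq_le_sq_mul_sq Finset.univ v w
  simpa [dotProduct, pow_two] using this

lemma wp_bound {d : ℕ} (G : Matrix (Fin d) (Fin d) ℝ) :
    ∃ c > (0 : ℝ), ∀ v, (G *ᵥ v) ⬝ᵥ (G *ᵥ v) ≤ c * (v ⬝ᵥ v) := by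
  refine ⟨(∑ i, (G i) ⬝ᵥ (G i)) + 1, ?_, fun v => ?_⟩
  · have : 0 ≤ ∑ i, (G i) ⬝ᵥ (G i) := Finset.sum_nonneg fun i _ => wp_dot_self_nonneg _
    linarith
  · have h1 : (G *ᵥ v) ⬝ᵥ (G *ᵥ v) ≤ ∑ i, (G i ⬝ᵥ G i) * (v ⬝ᵥ v) := by
      refine Finset.sum_le_sum fun i _ => ?_
      have := wp_cs (G i) v
      rw [pow_two] at this
      exact this
    rw [← Finset.sum_mul] at h1
    have := wp_dot_self_nonneg v
    linarith

/-- Step up: from `A` to `A + B`. -/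
lemma wp_up {d : ℕ} {A B : Matrix (Fin d) (Fin d) ℝ} (hA : A.PosDef) (hB : B.PosDef)
    {f : (Fin d → ℝ) → ℂ} (hf : Integrable f) (x₀ ξ₀ : Fin d → ℝ)
    (h : wpSmall A f x₀ ξ₀) : wpSmall (A + B) f x₀ ξ₀ := by
  obtain ⟨L, -, hL⟩ := wp_factor hB
  have hA' : ∀ s, 0 ≤ s ⬝ᵥ A *ᵥ s := fun s => by
    simpa using hA.posSemidef.dotProduct_mulVec_nonneg s
  refine wp_step (K := 0) (J := Lᵀ) hA' hf x₀ ξ₀ (κ := 1 / 2) (by norm_num)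
    (fun μ _ v => ((Real.exp (-(μ / 2) * (v ⬝ᵥ v)) : ℝ) : ℂ)) ?_ ?_ ?_ h
  · intro μ ξ
    simp only [dotProduct]
    fun_prop
  · intro μ hμ ξ v
    rw [Complex.norm_real, Real.norm_eq_abs, Real.abs_exp, mul_one_div]
  · intro μ hμ s ξ
    have hg := wp_gauss hμ (fun i => ((μ * (L *ᵥ s) i : ℝ) : ℂ) * Complex.I)
    have e : ∀ v : Fin d → ℝ, ((Real.exp (-(μ / 2) * (v ⬝ᵥ v)) : ℝ) : ℂ)
        * wpKer A μ (s + (0 : Matrix (Fin d) (Fin d) ℝ) *ᵥ v) (ξ + Lᵀ *ᵥ v)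
        = wpKer A μ s ξ * Complex.exp (((-(μ / 2) * (v ⬝ᵥ v) : ℝ) : ℂ)
          + ∑ i, (((μ * (L *ᵥ s) i : ℝ) : ℂ) * Complex.I) * v i) := by
      intro v
      have e1 : ∑ i, (((μ * (L *ᵥ s) i : ℝ) : ℂ) * Complex.I) * v i
          = ((μ * ((L *ᵥ s) ⬝ᵥ v) : ℝ) : ℂ) * Complex.I := by
        simp only [dotProduct]
        push_cast
        rw [Finset.mul_sum, Finset.sum_mul]
        exact Finset.sum_congr rfl fun i _ => by ring
      have e2 : s ⬝ᵥ Lᵀ *ᵥ v = (L *ᵥ s) ⬝ᵥ v := by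
        rw [dotProduct_mulVec, vecMul_transpose]
      rw [e1]
      unfold wpKer
      rw [zero_mulVec, add_zero, dotProduct_add, e2, Complex.ofReal_exp, ← Complex.exp_add,
        ← Complex.exp_add]
      congr 1
      push_cast
      ring
    simp_rw [e]
    rw [integral_const_mul, hg]
    have e3 : (∑ i, (((μ * (L *ᵥ s) i : ℝ) : ℂ) * Complex.I) ^ 2) / (2 * μ)
        = ((-(μ / 2) * (s ⬝ᵥ B *ᵥ s) : ℝ) : ℂ) := by
      rw [hL, wp_dot_factor]
      simp only [dotProduct, mul_pow, Complex.I_sq]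
      rw [← Finset.sum_mul]
      push_cast
      simp_rw [mul_pow]
      rw [← Finset.mul_sum]
      have : (μ : ℂ) ≠ 0 := by exact_mod_cast hμ.ne'
      field_simp
    rw [e3, mul_left_comm]
    congr 1
    unfold wpKer
    rw [← Complex.exp_add, add_mulVec, dotProduct_add]
    congr 1
    push_cast
    ring

/-- Step down: from `A + B` to `B`. -/
lemma wp_down {d : ℕ} {A B : Matrix (Fin d) (Fin d) ℝ} (hA : A.PosDef) (hB : B.PosDef)
    {f : (Fin d → ℝ) → ℂ} (hf : Integrable f) (x₀ ξ₀ : Fin d → ℝ)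
    (h : wpSmall (A + B) f x₀ ξ₀) : wpSmall B f x₀ ξ₀ := by
  obtain ⟨L, -, hL⟩ := wp_factor hA
  obtain ⟨H, hHu, hH⟩ := wp_factor hB
  obtain ⟨H', hH'⟩ : ∃ H', H' * H = 1 := hHu.exists_left_inv
  obtain ⟨a, ha, hab⟩ := wp_bound (L * H')
  have hM : (A + B).PosDef := hA.add hB
  have hM' : ∀ s, 0 ≤ s ⬝ᵥ (A + B) *ᵥ s := fun s => by
    simpa using hM.posSemidef.dotProduct_mulVec_nonneg s
  have hMt : (A + B)ᵀ = A + B := by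
    have := hM.isHermitian
    rwa [IsHermitian, conjTranspose_eq_transpose_of_trivial] at this
  obtain ⟨M', hMM⟩ : ∃ M', (A + B) * M' = 1 := hM.isUnit.exists_right_inv
  set M := A + B with hMdef
  set K := M' * Lᵀ with hK
  have hMK : ∀ v, M *ᵥ (K *ᵥ v) = Lᵀ *ᵥ v := fun v => by
    rw [mulVec_mulVec, hK, ← Matrix.mul_assoc, hMM, Matrix.one_mul]
  have hMs : ∀ s, s ⬝ᵥ M *ᵥ s = (L *ᵥ s) ⬝ᵥ (L *ᵥ s) + s ⬝ᵥ B *ᵥ s := fun s => by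
    rw [hMdef, add_mulVec, dotProduct_add, ← wp_dot_factor, ← hL]
  have hAB : ∀ s, (L *ᵥ s) ⬝ᵥ (L *ᵥ s) ≤ a * (s ⬝ᵥ B *ᵥ s) := fun s => by
    have := hab (H *ᵥ s)
    rwa [mulVec_mulVec, Matrix.mul_assoc, hH', Matrix.mul_one, ← wp_dot_factor H, ← hH] at this
  -- key inequality
  have hkey : ∀ v, (1 + a) * ((K *ᵥ v) ⬝ᵥ M *ᵥ (K *ᵥ v)) ≤ a * (v ⬝ᵥ v) := by
    intro v
    set u := K *ᵥ v
    have h1 : u ⬝ᵥ M *ᵥ u = (L *ᵥ u) ⬝ᵥ v := by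
      rw [hMK, dotProduct_mulVec, vecMul_transpose]
    have h2 := wp_cs (L *ᵥ u) v
    rw [← h1] at h2
    have h3 := hAB u
    have h4 := hMs u
    have hv := wp_dot_self_nonneg v
    set m := u ⬝ᵥ M *ᵥ u
    set l := (L *ᵥ u) ⬝ᵥ (L *ᵥ u)
    have hm : 0 ≤ m := hM' u
    have h5 : (1 + a) * l ≤ a * m := by nlinarith
    rcases hm.eq_or_lt with h0 | h0
    · rw [← h0]; nlinarith [mul_nonneg ha.le hv]
    · refine le_of_mul_le_mul_left ?_ h0
      nlinarith [mul_le_mul_of_nonneg_right h5 hv]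
  refine wp_step (A := M) (K := -K) (J := 0) hM' hf x₀ ξ₀ (κ := 1 / (2 * (1 + a))) (by positivity)
    (fun μ ξ v => Complex.exp (((-(μ / 2) * (v ⬝ᵥ v - (K *ᵥ v) ⬝ᵥ M *ᵥ (K *ᵥ v)) : ℝ) : ℂ)
      + ((μ * ((K *ᵥ v) ⬝ᵥ ξ) : ℝ) : ℂ) * Complex.I)) ?_ ?_ ?_ h
  · intro μ ξ
    simp only [dotProduct, mulVec]
    fun_prop
  · intro μ hμ ξ v
    rw [Complex.norm_exp]
    simp only [Complex.add_re, Complex.ofReal_re, Complex.mul_re, Complex.I_re, Complex.I_im,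
      Complex.ofReal_im, mul_zero, mul_one, sub_zero, add_zero, Real.exp_le_exp]
    have h1 := hkey v
    set m := (K *ᵥ v) ⬝ᵥ M *ᵥ (K *ᵥ v)
    have h2 : (1 / (1 + a)) * (v ⬝ᵥ v) ≤ v ⬝ᵥ v - m := by
      rw [div_mul_eq_mul_div, div_le_iff₀ (by positivity)]
      nlinarith
    have h3 := mul_le_mul_of_nonneg_left h2 (by positivity : 0 ≤ μ / 2)
    have h4 : μ / 2 * (1 / (1 + a) * (v ⬝ᵥ v)) = μ * (1 / (2 * (1 + a))) * (v ⬝ᵥ v) := by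
      field_simp
    linarith
  · intro μ hμ s ξ
    have hg := wp_gauss hμ (fun i => ((μ * (L *ᵥ s) i : ℝ) : ℂ))
    have e : ∀ v : Fin d → ℝ,
        Complex.exp (((-(μ / 2) * (v ⬝ᵥ v - (K *ᵥ v) ⬝ᵥ M *ᵥ (K *ᵥ v)) : ℝ) : ℂ)
          + ((μ * ((K *ᵥ v) ⬝ᵥ ξ) : ℝ) : ℂ) * Complex.I)
        * wpKer M μ (s + (-K) *ᵥ v) (ξ + (0 : Matrix (Fin d) (Fin d) ℝ) *ᵥ v)
        = wpKer M μ s ξ * Complex.exp (((-(μ / 2) * (v ⬝ᵥ v) : ℝ) : ℂ)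
          + ∑ i, ((μ * (L *ᵥ s) i : ℝ) : ℂ) * v i) := by
      intro v
      have e1 : ∑ i, ((μ * (L *ᵥ s) i : ℝ) : ℂ) * v i
          = ((μ * ((L *ᵥ s) ⬝ᵥ v) : ℝ) : ℂ) := by
        simp only [dotProduct]
        push_cast
        rw [Finset.mul_sum]
        exact Finset.sum_congr rfl fun i _ => by ring
      have e2 : s ⬝ᵥ M *ᵥ (K *ᵥ v) = (L *ᵥ s) ⬝ᵥ v := by
        rw [hMK, dotProduct_mulVec, vecMul_transpose]
      have e2' : (K *ᵥ v) ⬝ᵥ M *ᵥ s = (L *ᵥ s) ⬝ᵥ v := by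
        rw [← e2, dotProduct_comm, dotProduct_mulVec s, ← mulVec_transpose, hMt]
      have e4 : (s - K *ᵥ v) ⬝ᵥ M *ᵥ (s - K *ᵥ v)
          = s ⬝ᵥ M *ᵥ s - 2 * ((L *ᵥ s) ⬝ᵥ v) + (K *ᵥ v) ⬝ᵥ M *ᵥ (K *ᵥ v) := by
        rw [mulVec_sub, sub_dotProduct, dotProduct_sub, dotProduct_sub, e2, e2']
        ring
      rw [e1]
      unfold wpKer
      rw [zero_mulVec, add_zero, neg_mulVec, ← sub_eq_add_neg, e4, sub_dotProduct,
        ← Complex.exp_add, ← Complex.exp_add]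
      congr 1
      push_cast
      ring
    simp_rw [e]
    rw [integral_const_mul, hg]
    have e3 : (∑ i, ((μ * (L *ᵥ s) i : ℝ) : ℂ) ^ 2) / (2 * μ)
        = ((μ / 2 * ((L *ᵥ s) ⬝ᵥ (L *ᵥ s)) : ℝ) : ℂ) := by
      simp only [dotProduct]
      push_cast
      simp_rw [mul_pow]
      rw [← Finset.mul_sum]
      have : (μ : ℂ) ≠ 0 := by exact_mod_cast hμ.ne'
      field_simp
    rw [e3, mul_left_comm]
    congr 1
    unfold wpKer
    rw [← Complex.exp_add, hMs]
    congr 1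
    push_cast
    ring

lemma wp_iff {d : ℕ} {A B : Matrix (Fin d) (Fin d) ℝ} (hA : A.PosDef) (hB : B.PosDef)
    {f : (Fin d → ℝ) → ℂ} (hf : Integrable f) (x₀ ξ₀ : Fin d → ℝ) :
    wpSmall A f x₀ ξ₀ ↔ wpSmall B f x₀ ξ₀ := by
  refine ⟨fun h => wp_down hA hB hf _ _ (wp_up hA hB hf _ _ h),
    fun h => wp_down hB hA hf _ _ (wp_up hB hA hf _ _ h)⟩

/-- Relation between the FBI kernel and the wave packet kernel. -/
lemma wp_fbi_ker {d : ℕ} {Q : Matrix (Fin d) (Fin d) ℝ} (hQ : Qᵀ = Q) (z : Fin d → ℂ)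
    (y : Fin d → ℝ) (μ : ℝ) :
    Complex.exp (-(μ / 2 : ℂ) * quadFormC Q (fun j => z j - (y j : ℂ)))
      = ((Real.exp (μ / 2 * quadFormR Q (fun j => (z j).im)) : ℝ) : ℂ)
        * wpKer Q μ ((fun j => (z j).re) - y) (-(Q *ᵥ fun j => (z j).im)) := by
  set s : Fin d → ℝ := (fun j => (z j).re) - y with hs
  set t : Fin d → ℝ := fun j => (z j).im with ht
  have hz : ∀ j, z j - (y j : ℂ) = (s j : ℂ) + (t j : ℂ) * Complex.I := by
    intro j
    apply Complex.ext <;> simp [hs, ht]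
  have hsw : ∑ j, ∑ k, (Q j k : ℂ) * t j * s k = ∑ j, ∑ k, (Q j k : ℂ) * s j * t k := by
    rw [Finset.sum_comm]
    refine Finset.sum_congr rfl fun j _ => Finset.sum_congr rfl fun k _ => ?_
    have : Q k j = Q j k := by conv_rhs => rw [← hQ, transpose_apply]
    rw [this]; ring
  have hq : quadFormC Q (fun j => z j - (y j : ℂ))
      = ((s ⬝ᵥ Q *ᵥ s : ℝ) : ℂ) - ((quadFormR Q t : ℝ) : ℂ)
        + 2 * ((s ⬝ᵥ Q *ᵥ t : ℝ) : ℂ) * Complex.I := by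
    have e1 : ((s ⬝ᵥ Q *ᵥ s : ℝ) : ℂ) = ∑ j, ∑ k, (Q j k : ℂ) * s j * s k := by
      simp only [dotProduct, mulVec, Finset.mul_sum]
      push_cast
      exact Finset.sum_congr rfl fun j _ => Finset.sum_congr rfl fun k _ => by ring
    have e2 : ((s ⬝ᵥ Q *ᵥ t : ℝ) : ℂ) = ∑ j, ∑ k, (Q j k : ℂ) * s j * t k := by
      simp only [dotProduct, mulVec, Finset.mul_sum]
      push_cast
      exact Finset.sum_congr rfl fun j _ => Finset.sum_congr rfl fun k _ => by ring
    have e3 : ((quadFormR Q t : ℝ) : ℂ) = ∑ j, ∑ k, (Q j k : ℂ) * t j * t k := by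
      simp only [quadFormR]
      push_cast
      rfl
    have e4 : quadFormC Q (fun j => z j - (y j : ℂ))
        = ∑ j, ∑ k, (Q j k : ℂ) * s j * s k - ∑ j, ∑ k, (Q j k : ℂ) * t j * t k
          + (∑ j, ∑ k, (Q j k : ℂ) * s j * t k + ∑ j, ∑ k, (Q j k : ℂ) * t j * s k)
            * Complex.I := by
      simp only [quadFormC, hz, ← Finset.sum_add_distrib, ← Finset.sum_sub_distrib,
        Finset.sum_mul]
      refine Finset.sum_congr rfl fun j _ => Finset.sum_congr rfl fun k _ => ?_
      linear_combination (Q j k : ℂ) * t j * t k * Complex.I_sq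
    rw [e4, hsw, e1, e2, e3]
    ring
  rw [hq]
  unfold wpKer
  rw [Complex.ofReal_exp, ← Complex.exp_add, dotProduct_neg]
  congr 1
  push_cast
  ring

lemma wp_fbi_norm {d : ℕ} {Q : Matrix (Fin d) (Fin d) ℝ} (hQ : Qᵀ = Q) (f : (Fin d → ℝ) → ℂ)
    (z : Fin d → ℂ) (μ : ℝ) :
    ‖∫ x : Fin d → ℝ, Complex.exp (-(μ / 2 : ℂ) * quadFormC Q (fun j => z j - (x j : ℂ))) * f x‖
      = Real.exp (μ / 2 * quadFormR Q (fun j => (z j).im))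
        * ‖wpT Q f μ (fun j => (z j).re) (-(Q *ᵥ fun j => (z j).im))‖ := by
  simp_rw [wp_fbi_ker hQ, mul_assoc]
  rw [integral_const_mul, norm_mul, Complex.norm_real, Real.norm_eq_abs, Real.abs_exp]
  rfl

lemma wp_fbi_iff {d : ℕ} {Q : Matrix (Fin d) (Fin d) ℝ} (hQ : Q.PosDef) (f : (Fin d → ℝ) → ℂ)
    (x₀ ξ₀ : Fin d → ℝ) :
    (∃ N : Set (Fin d → ℂ), IsOpen N ∧
      (fun j => (x₀ j : ℂ) - ((Q⁻¹.mulVec ξ₀) j : ℂ) * Complex.I) ∈ N ∧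
      ∃ ε > (0 : ℝ), ∃ C > (0 : ℝ),
        ∀ z ∈ N, ∀ μ : ℝ, 1 ≤ μ →
          norm (∫ x : Fin d → ℝ,
              Complex.exp (-(μ / 2 : ℂ) * quadFormC Q (fun j => z j - (x j : ℂ))) * f x)
            ≤ C * Real.exp (μ / 2 * (quadFormR Q (fun j => (z j).im) - ε)))
    ↔ wpSmall Q f x₀ ξ₀ := by
  have hQt : Qᵀ = Q := by
    have := hQ.isHermitian
    rwa [IsHermitian, conjTranspose_eq_transpose_of_trivial] at this
  have hdet : IsUnit Q.det := (Matrix.isUnit_iff_isUnit_det _).1 hQ.isUnit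
  have hQQ : ∀ ξ, Q *ᵥ (Q⁻¹ *ᵥ ξ) = ξ := fun ξ => by
    rw [mulVec_mulVec, Matrix.mul_nonsing_inv _ hdet, one_mulVec]
  have hsplit : ∀ μ a ε C : ℝ, C * Real.exp (μ / 2 * (a - ε))
      = Real.exp (μ / 2 * a) * (C * Real.exp (-(ε / 2 * μ))) := by
    intro μ a ε C
    rw [mul_left_comm, ← Real.exp_add]
    congr 2
    ring
  simp_rw [wp_fbi_norm hQt, hsplit, mul_le_mul_iff_right₀ (Real.exp_pos _)]
  constructor
  · rintro ⟨N, hN, hmem, ε, hε, C, hC, hb⟩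
    refine ⟨ε / 2, by positivity, C, hC, ?_⟩
    have hc : Continuous fun p : (Fin d → ℝ) × (Fin d → ℝ) =>
        (fun j => (p.1 j : ℂ) - ((Q⁻¹ *ᵥ p.2) j : ℂ) * Complex.I) := by
      have : Continuous fun p : (Fin d → ℝ) × (Fin d → ℝ) => Q⁻¹ *ᵥ p.2 :=
        continuous_const.matrix_mulVec continuous_snd
      fun_prop
    filter_upwards [(hN.preimage hc).mem_nhds (x := (x₀, ξ₀)) hmem] with p hp μ hμ
    have := hb _ hp μ hμ
    have e1 : (fun j => ((p.1 j : ℂ) - ((Q⁻¹ *ᵥ p.2) j : ℂ) * Complex.I).re) = p.1 := by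
      ext j; simp
    have e2 : (fun j => ((p.1 j : ℂ) - ((Q⁻¹ *ᵥ p.2) j : ℂ) * Complex.I).im)
        = -(Q⁻¹ *ᵥ p.2) := by
      ext j; simp
    rwa [e1, e2, mulVec_neg, neg_neg, hQQ] at this
  · rintro ⟨ε, hε, C, hC, hev⟩
    obtain ⟨U, hU, hUo, hUm⟩ := eventually_nhds_iff.1 hev
    have hc : Continuous fun z : Fin d → ℂ =>
        ((fun j => (z j).re), -(Q *ᵥ fun j => (z j).im)) := by
      refine Continuous.prodMk (by fun_prop) (Continuous.neg ?_)
      exact continuous_const.matrix_mulVec (by fun_prop)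
    refine ⟨_, hUo.preimage hc, ?_, 2 * ε, by positivity, C, hC, fun z hz μ hμ => ?_⟩
    · have e1 : (fun j => ((x₀ j : ℂ) - ((Q⁻¹ *ᵥ ξ₀) j : ℂ) * Complex.I).re) = x₀ := by
        ext j; simp
      have e2 : (fun j => ((x₀ j : ℂ) - ((Q⁻¹ *ᵥ ξ₀) j : ℂ) * Complex.I).im)
          = -(Q⁻¹ *ᵥ ξ₀) := by
        ext j; simp
      rw [Set.mem_preimage, e1, e2, mulVec_neg, neg_neg, hQQ]
      exact hUm
    · have := hU _ hz μ hμ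
      rwa [mul_div_cancel_left₀ _ (two_ne_zero)]

/-- The characterization of the analytic wave front set via the standard FBI transform
agrees with the characterization via the generalized FBI transform relative to any
positive definite quadratic form `q`. -/
theorem fbi_wavefront_characterizations_agree
    (d : ℕ) (hd : 1 ≤ d) (f : (Fin d → ℝ) → ℂ) (hf : Integrable f)
    (x₀ ξ₀ : Fin d → ℝ) (hξ₀ : ξ₀ ≠ 0)
    (Q : Matrix (Fin d) (Fin d) ℝ) (hQsymm : Q.IsSymm) (hQpos : Q.PosDef) :
    (∃ Z : Set (Fin d → ℂ), IsOpen Z ∧ (fun j => (x₀ j : ℂ) - (ξ₀ j : ℂ) * Complex.I) ∈ Z ∧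
      ∃ ε > (0 : ℝ), ∃ C > (0 : ℝ),
        ∀ z ∈ Z, ∀ μ : ℝ, 1 ≤ μ →
          norm (∫ x : Fin d → ℝ,
              Complex.exp (-(μ / 2 : ℂ) * ∑ j, (z j - (x j : ℂ)) ^ 2) * f x)
            ≤ C * Real.exp (μ / 2 * ((∑ j, (z j).im ^ 2) - ε))) ↔
    (∃ N : Set (Fin d → ℂ), IsOpen N ∧
      (fun j => (x₀ j : ℂ) - ((Q⁻¹.mulVec ξ₀) j : ℂ) * Complex.I) ∈ N ∧
      ∃ ε > (0 : ℝ), ∃ C > (0 : ℝ),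
        ∀ z ∈ N, ∀ μ : ℝ, 1 ≤ μ →
          norm (∫ x : Fin d → ℝ,
              Complex.exp (-(μ / 2 : ℂ) * quadFormC Q (fun j => z j - (x j : ℂ))) * f x)
            ≤ C * Real.exp (μ / 2 * (quadFormR Q (fun j => (z j).im) - ε))) := by
  have h1 : (1 : Matrix (Fin d) (Fin d) ℝ).PosDef := Matrix.PosDef.one
  rw [wp_fbi_iff hQpos, wp_iff hQpos h1 hf, ← wp_fbi_iff h1]
  have eC : ∀ z : Fin d → ℂ, quadFormC 1 z = ∑ j, (z j) ^ 2 := by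
    intro z
    simp [quadFormC, Matrix.one_apply, pow_two, apply_ite Complex.ofReal, ite_mul]
  have eR : ∀ v : Fin d → ℝ, quadFormR 1 v = ∑ j, (v j) ^ 2 := by
    intro z
    simp [quadFormR, Matrix.one_apply, pow_two]
  simp only [eC, eR, inv_one, Matrix.one_mulVec]
end

section
/- Let U ⊆ ℝ^k be open, let M : U → Matrix n n ℂ be continuous, let x₀ ∈ U, and let λ₀ ∈ ℂ be an eigenvalue of M(x₀) of algebraic multiplicity m (the multiplicity of λ₀ as a root of the characteristic polynomial of M(x₀) is m). Then for every r > 0 such that λ₀ is the only eigenvalue of M(x₀) in the closed disk of radius r centered at λ₀, there exists an open neighborhood V ⊆ U of x₀ such that for every x ∈ V, the characteristic polynomial of M(x) has exactly m roots, counted with multiplicity, in the open disk B(λ₀, r) ⊆ ℂ. -/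
open Polynomial
open scoped Classical

lemma exists_root_vector {n : ℕ} (A : Matrix (Fin n) (Fin n) ℂ) :
    ∃ f : Fin n → ℂ, A.charpoly.roots = Multiset.map f Finset.univ.val := by
  have hc : A.charpoly.roots.card = n := by
    rw [← (IsAlgClosed.splits A.charpoly).natDegree_eq_card_roots,
      Matrix.charpoly_natDegree_eq_dim, Fintype.card_fin]
  obtain ⟨l, hl⟩ := Quot.exists_rep A.charpoly.roots
  have hl' : (l : Multiset ℂ) = A.charpoly.roots := hl
  rw [← hl'] at hc ⊢
  have hc' : l.length = n := by simpa using hc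
  subst hc'
  refine ⟨fun i => l.get i, ?_⟩
  have h := Fin.univ_val_map (fun i => l.get i)
  rw [h, List.ofFn_get]

lemma root_norm_le {n : ℕ} (A : Matrix (Fin n) (Fin n) ℂ) (μ : ℂ)
    (h : μ ∈ A.charpoly.roots) : ‖μ‖ ≤ ∑ i, ∑ j, ‖A i j‖ := by
  have h1 : A.charpoly.IsRoot μ := (Polynomial.mem_roots'.1 h).2
  have h2 : Module.End.HasEigenvalue (Matrix.toLin' A) μ := by
    rw [Module.End.hasEigenvalue_iff_isRoot_charpoly, Matrix.charpoly_toLin']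
    exact h1
  obtain ⟨k, hk⟩ := eigenvalue_mem_ball h2
  rw [mem_closedBall_iff_norm] at hk
  have h3 : ‖μ‖ ≤ ‖A k k‖ + ∑ j ∈ Finset.univ.erase k, ‖A k j‖ := by
    have := norm_le_norm_add_norm_sub' μ (A k k)
    linarith
  rw [Finset.add_sum_erase _ (fun j => ‖A k j‖) (Finset.mem_univ k)] at h3
  exact h3.trans (Finset.single_le_sum (f := fun i => ∑ j, ‖A i j‖)
    (fun i _ => Finset.sum_nonneg fun j _ => norm_nonneg _) (Finset.mem_univ k))

lemma charpoly_eq_prod {n : ℕ} (A : Matrix (Fin n) (Fin n) ℂ) (f : Fin n → ℂ)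
    (hf : A.charpoly.roots = Multiset.map f Finset.univ.val) :
    A.charpoly = ∏ i, (X - C (f i)) := by
  have h := (IsAlgClosed.splits A.charpoly).eq_prod_roots_of_monic A.charpoly_monic
  rw [hf, Multiset.map_map] at h
  exact h

/-- Continuity of the spectrum of a matrix with respect to a parameter: if
`M : U → Matrix n n ℂ` is continuous and `λ₀` is an eigenvalue of `M(x₀)` of algebraic
multiplicity `m`, then for any `r > 0` such that `λ₀` is the only eigenvalue of `M(x₀)`
in the closed disk of radius `r`, the matrix `M(x)` has exactly `m` eigenvalues
(counted with multiplicity) in the open disk `B(λ₀, r)` for all `x` near `x₀`. -/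
theorem spectrum_continuous_in_parameter
    (k n : ℕ) (U : Set (Fin k → ℝ)) (hU : IsOpen U)
    (M : (Fin k → ℝ) → Matrix (Fin n) (Fin n) ℂ)
    (hM : ∀ i j, ContinuousOn (fun x => M x i j) U)
    (x₀ : Fin k → ℝ) (hx₀ : x₀ ∈ U)
    (lam₀ : ℂ) (m : ℕ) (hroot : (M x₀).charpoly.IsRoot lam₀)
    (hmult : rootMultiplicity lam₀ (M x₀).charpoly = m) :
    ∀ r : ℝ, 0 < r →
      (∀ μ : ℂ, (M x₀).charpoly.IsRoot μ → ‖μ - lam₀‖ ≤ r → μ = lam₀) →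
      ∃ V : Set (Fin k → ℝ), IsOpen V ∧ x₀ ∈ V ∧ V ⊆ U ∧
        ∀ x ∈ V,
          ((M x).charpoly.roots.filter (fun μ => μ ∈ Metric.ball lam₀ r)).card = m := by
  intro r hr hiso
  have hev : ∀ᶠ x in nhds x₀,
      ((M x).charpoly.roots.filter (fun μ => μ ∈ Metric.ball lam₀ r)).card = m := by
    have hcont : ∀ i j, ContinuousAt (fun x => M x i j) x₀ := fun i j =>
      (hM i j).continuousAt (hU.mem_nhds hx₀)
    have hMc : ContinuousAt M x₀ :=
      continuousAt_pi.2 fun i => continuousAt_pi.2 fun j => hcont i j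
    choose z hz using fun x => exists_root_vector (M x)
    set B : ℝ := (∑ i, ∑ j, ‖M x₀ i j‖) + 1 with hB
    have hbd : ∀ᶠ x in nhds x₀, z x ∈ Set.pi Set.univ (fun _ => Metric.closedBall (0 : ℂ) B) := by
      have hc : ContinuousAt (fun x => ∑ i, ∑ j, ‖M x i j‖) x₀ :=
        tendsto_finsetSum _ fun i _ => tendsto_finsetSum _ fun j _ => (hcont i j).norm
      filter_upwards [hc.eventually (gt_mem_nhds (lt_add_one _))] with x hx i _
      rw [mem_closedBall_zero_iff]
      refine (root_norm_le (M x) (z x i) ?_).trans hx.le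
      rw [hz x]
      exact Multiset.mem_map_of_mem _ (Finset.mem_univ i)
    refine Filter.mem_iff_ultrafilter.2 fun F hF => ?_
    have hcpt : IsCompact (Set.pi Set.univ (fun _ : Fin n => Metric.closedBall (0 : ℂ) B)) :=
      isCompact_univ_pi fun _ => isCompact_closedBall _ _
    obtain ⟨w, -, hw⟩ := hcpt.ultrafilter_le_nhds (F.map z)
      (Filter.le_principal_iff.2 (hF hbd))
    have hw' : Filter.Tendsto z F (nhds w) := hw
    have hwi : ∀ i, Filter.Tendsto (fun x => z x i) F (nhds (w i)) := tendsto_pi_nhds.1 hw'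
    have hpoly : (M x₀).charpoly = ∏ i, (X - C (w i)) := by
      refine Polynomial.funext fun t => ?_
      have h1 : Filter.Tendsto (fun x => (M x).charpoly.eval t) F
          (nhds ((M x₀).charpoly.eval t)) := by
        simp only [Matrix.eval_charpoly]
        have : ContinuousAt (fun x => (Matrix.scalar (Fin n) t - M x).det) x₀ := by
          have hd : Continuous fun A : Matrix (Fin n) (Fin n) ℂ =>
            (Matrix.scalar (Fin n) t - A).det := by fun_prop
          exact hd.continuousAt.comp hMc
        exact this.mono_left hF
      have h2 : Filter.Tendsto (fun x => (M x).charpoly.eval t) F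
          (nhds ((∏ i, (X - C (w i))).eval t)) := by
        simp only [charpoly_eq_prod _ _ (hz _), eval_prod, eval_sub, eval_X, eval_C]
        exact tendsto_finsetProd _ fun i _ => tendsto_const_nhds.sub (hwi i)
      exact tendsto_nhds_unique h1 h2
    have hroots : (M x₀).charpoly.roots = Multiset.map w Finset.univ.val := by
      have h := Polynomial.roots_multiset_prod_X_sub_C (Multiset.map w Finset.univ.val)
      rw [Multiset.map_map] at h
      rw [hpoly]
      exact h
    have hm : (Finset.univ.filter (fun i => w i = lam₀)).card = m := by
      rw [← hmult, ← Polynomial.count_roots, hroots, Multiset.count_map]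
      simp only [eq_comm (a := lam₀)]
      rfl
    have hiff : ∀ i, ∀ᶠ x in (F : Filter (Fin k → ℝ)),
        (z x i ∈ Metric.ball lam₀ r ↔ w i = lam₀) := by
      intro i
      by_cases h : w i = lam₀
      · have := (hwi i).eventually (Metric.isOpen_ball.mem_nhds
          (h ▸ Metric.mem_ball_self hr : w i ∈ Metric.ball lam₀ r))
        filter_upwards [this] with x hx
        exact ⟨fun _ => h, fun _ => hx⟩
      · have hnot : w i ∈ (Metric.closedBall lam₀ r)ᶜ := by
          intro hc
          refine h (hiso (w i) ?_ (mem_closedBall_iff_norm.1 hc))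
          have : w i ∈ (M x₀).charpoly.roots := by
            rw [hroots]
            exact Multiset.mem_map_of_mem _ (Finset.mem_univ i)
          exact (Polynomial.mem_roots'.1 this).2
        have := (hwi i).eventually (Metric.isClosed_closedBall.isOpen_compl.mem_nhds hnot)
        filter_upwards [this] with x hx
        exact ⟨fun hb => absurd (Metric.ball_subset_closedBall hb) hx, fun hb => absurd hb h⟩
    have hall := Filter.eventually_all.2 hiff
    change ∀ᶠ x in (F : Filter (Fin k → ℝ)), _
    filter_upwards [hall] with x hx
    rw [hz x, Multiset.filter_map, Multiset.card_map, ← hm]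
    have : Finset.univ.filter (fun i => w i = lam₀) =
        Finset.univ.filter (fun i => z x i ∈ Metric.ball lam₀ r) :=
      Finset.filter_congr fun i _ => (hx i).symm
    rw [this]
    rfl
  obtain ⟨V, hV, hVo, hxV⟩ := eventually_nhds_iff.1 (hev.and (hU.mem_nhds hx₀))
  exact ⟨V, hVo, hxV, fun x hx => (hV x hx).2, fun x hx => (hV x hx).1⟩
end
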